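/- Let K be a field of characteristic zero and let f_1, ..., f_n be polynomials in K[x_1, ..., x_n]. Then f_1, ..., f_n are algebraically independent over K if and only if the determinant of the Jacobian matrix (∂f_i/∂x_j)_{1 ≤ i,j ≤ n}, which is an element of K[x_1, ..., x_n], is nonzero. -/

import Mathlib

namespace MvPolynomial

/-- The chain rule for a derivation applied to a polynomial expression. -/
theorem derivation_aeval {R A σ : Type*} [CommRing R] [CommRing A] [Algebra R A] [Fintype σ]
    (D : Derivation R A A) (f : σ → A) (p : MvPolynomial σ R) :
    D (aeval f p) = ∑ i, aeval f (pderiv i p) * D (f i) := by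
  classical
  induction p using MvPolynomial.induction_on with
  | C a => simp
  | add p q hp hq => simp [hp, hq, add_mul, Finset.sum_add_distrib]
  | mul_X p j h =>
    simp only [map_mul, aeval_X, Derivation.leibniz, smul_eq_mul, h, map_add, add_mul,
      Finset.sum_add_distrib, pderiv_X, Finset.mul_sum]
    congr 1
    · simp [Pi.single_apply, apply_ite]
    · exact Finset.sum_congr rfl fun i _ => by ring

theorem totalDegree_pderiv_le {R σ : Type*} [CommSemiring R] (i : σ) (p : MvPolynomial σ R) :
    (pderiv i p).totalDegree ≤ p.totalDegree - 1 := by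
  classical
  refine Finset.sup_le fun m hm => ?_
  have hp : m + Finsupp.single i 1 ∈ p.support := by
    rw [mem_support_iff] at hm ⊢
    intro h
    simp [coeff_pderiv, h] at hm
  have h := le_totalDegree hp
  rw [Finsupp.sum_add_index' (by simp) (by simp), Finsupp.sum_single_index rfl] at h
  omega

theorem eq_C_of_forall_pderiv_eq_zero {R σ : Type*} [CommRing R] [IsDomain R] [CharZero R]
    {p : MvPolynomial σ R} (h : ∀ i, pderiv i p = 0) : p = C (coeff 0 p) := by
  classical
  ext m
  rw [coeff_C]
  split_ifs with hm
  · rw [hm]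
  · obtain ⟨i, hi⟩ : ∃ i, m i ≠ 0 := by
      by_contra! h0
      exact hm (Finsupp.ext fun i => (h0 i).symm)
    have hmi : m - Finsupp.single i 1 + Finsupp.single i 1 = m :=
      tsub_add_cancel_of_le (by simpa [Nat.one_le_iff_ne_zero] using hi)
    have hc := coeff_pderiv (i := i) p (m - Finsupp.single i 1)
    rw [h i, hmi, coeff_zero, eq_comm, mul_eq_zero] at hc
    exact hc.resolve_right (Nat.cast_add_one_ne_zero _)

end MvPolynomial

/-- A derivation over a domain of characteristic zero kills every algebraic element. -/
theorem Derivation.eq_zero_of_isAlgebraic {R A : Type*} [CommRing R] [CommRing A] [IsDomain A]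
    [Algebra R A] [FaithfulSMul R A] [CharZero A] (D : Derivation R A A) {x : A}
    (hx : IsAlgebraic R x) : D x = 0 := by
  have hR := FaithfulSMul.algebraMap_injective R A
  have : IsDomain R := hR.isDomain (algebraMap R A)
  have : CharZero R := ⟨fun a b h => by
    have := congrArg (algebraMap R A) h
    simpa using this⟩
  by_contra hD
  suffices ∀ n : ℕ, ∀ p : Polynomial R, p.natDegree ≤ n → Polynomial.aeval x p = 0 → p = 0 by
    obtain ⟨p, hp, hpx⟩ := hx
    exact hp (this _ p le_rfl hpx)
  intro n
  induction n with
  | zero =>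
    intro p hp hpx
    rw [Polynomial.eq_C_of_natDegree_le_zero hp, Polynomial.aeval_C,
      map_eq_zero_iff _ hR] at hpx
    rw [Polynomial.eq_C_of_natDegree_le_zero hp, hpx, map_zero]
  | succ n ih =>
    intro p hp hpx
    have hd : Polynomial.derivative p = 0 := by
      refine ih _ ((Polynomial.natDegree_derivative_le p).trans (by omega)) ?_
      have h := D.map_aeval p x
      rw [hpx, map_zero, eq_comm, smul_eq_mul, mul_eq_zero] at h
      exact h.resolve_right hD
    exact ih p ((Polynomial.derivative_eq_zero.mp hd).trans_le n.zero_le) hpx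

/-- A derivation is linear over any subalgebra on which it vanishes. -/
def Derivation.restrictSubalgebra {R A : Type*} [CommRing R] [CommRing A] [Algebra R A]
    (D : Derivation R A A) (S : Subalgebra R A) (hS : ∀ s ∈ S, D s = 0) : Derivation S A A :=
  Derivation.mk'
    { toFun := D
      map_add' := map_add D
      map_smul' := fun s a => by
        simp [Subalgebra.smul_def, hS s s.2] }
    fun a b => D.leibniz a b

namespace MvPolynomial

variable {K σ : Type*} [Field K] [CharZero K] [Fintype σ] [DecidableEq σ]
  {f : σ → MvPolynomial σ K}

theorem algebraicIndependent_of_det_pderiv_ne_zero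
    (hdet : (Matrix.of fun i j => pderiv j (f i)).det ≠ 0) : AlgebraicIndependent K f := by
  rw [algebraicIndependent_iff]
  suffices ∀ n : ℕ, ∀ p : MvPolynomial σ K, p.totalDegree ≤ n → aeval f p = 0 → p = 0 from
    fun p => this _ p le_rfl
  have hC : ∀ p : MvPolynomial σ K, p = C (coeff 0 p) → aeval f p = 0 → p = 0 := by
    intro p hp h
    rw [hp, aeval_C, algebraMap_eq, C_eq_zero] at h
    rw [hp, h, C_0]
  intro n
  induction n with
  | zero => exact fun p hp => hC p (totalDegree_eq_zero_iff_eq_C.mp (Nat.le_zero.mp hp))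
  | succ n ih =>
    intro p hp h
    have hv : (fun i => aeval f (pderiv i p)) = 0 := by
      refine Matrix.eq_zero_of_vecMul_eq_zero hdet ?_
      funext j
      have := derivation_aeval (pderiv j) f p
      rw [h, map_zero] at this
      exact this.symm
    refine hC p (eq_C_of_forall_pderiv_eq_zero fun i => ih _ ?_ (congrFun hv i)) h
    exact (totalDegree_pderiv_le i p).trans (by omega)

theorem det_pderiv_ne_zero_of_algebraicIndependent (hf : AlgebraicIndependent K f) :
    (Matrix.of fun i j => pderiv j (f i)).det ≠ 0 := by
  intro hdet
  obtain ⟨v, hv, hJv⟩ := Matrix.exists_mulVec_eq_zero_iff.mpr hdet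
  have htr : Algebra.trdeg K (MvPolynomial σ K) = Cardinal.lift (Cardinal.mk σ) :=
    trdeg_of_isDomain
  have hb : IsTranscendenceBasis K f :=
    hf.isTranscendenceBasis_of_lift_trdeg_le (by rw [htr]; simp) (by rw [htr]; simp)
  have halg := hb.isAlgebraic
  let D : Derivation K (MvPolynomial σ K) (MvPolynomial σ K) := mkDerivation K v
  have hD : ∀ p, D p = ∑ j, pderiv j p * v j := fun p => by
    simpa [D] using derivation_aeval D X p
  have hDf : ∀ s ∈ Algebra.adjoin K (Set.range f), D s = 0 := by
    intro s hs
    induction hs using Algebra.adjoin_induction with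
    | mem x hx =>
      obtain ⟨i, rfl⟩ := hx
      rw [hD]
      exact congrFun hJv i
    | algebraMap r => exact D.map_algebraMap r
    | add x y _ _ hx hy => rw [map_add, hx, hy, add_zero]
    | mul x y _ _ hx hy => rw [D.leibniz, hx, hy, smul_zero, smul_zero, add_zero]
  refine hv ?_
  funext j
  have h : D (X j) = 0 :=
    (D.restrictSubalgebra _ hDf).eq_zero_of_isAlgebraic (halg.isAlgebraic (X j))
  simpa [D] using h

end MvPolynomial

/-- Jacobian criterion: over a field K of characteristic zero, polynomials
f_1, ..., f_n in K[x_1,...,x_n] are algebraically independent over K if and only if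
the determinant of their Jacobian matrix (∂f_i/∂x_j) is a nonzero element of
K[x_1,...,x_n]. -/
theorem stmt_9 (K : Type*) [Field K] [CharZero K] (n : ℕ)
    (f : Fin n → MvPolynomial (Fin n) K) :
    AlgebraicIndependent K f ↔
      Matrix.det (Matrix.of fun i j : Fin n => MvPolynomial.pderiv j (f i)) ≠ 0 :=
  ⟨MvPolynomial.det_pderiv_ne_zero_of_algebraicIndependent,
    MvPolynomial.algebraicIndependent_of_det_pderiv_ne_zero⟩
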